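/- Let $u: \overline{\mathbb{S}} \to [0,\infty)$ be continuous, bounded, and subharmonic on the open strip $\mathbb{S} = \{z : 0 < \mathrm{Re}(z) < 1\}$. Then for every $z \in \mathbb{S}$, $u(z) \leq \int_{\mathbb{R}} u(it) P_0(z, it)\,dt + \int_{\mathbb{R}} u(1+it) P_1(z, 1+it)\,dt$, where $P_0, P_1$ are the two components of the Poisson kernel of the strip (the harmonic measures of the two boundary lines); in particular, the integrals of the Poisson kernel components satisfy $\int_{\mathbb{R}} P_0(z, it)\,dt = 1 - \mathrm{Re}(z)$ and $\int_{\mathbb{R}} P_1(z, 1+it)\,dt = \mathrm{Re}(z)$. -/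

import Mathlib

open Filter Topology MeasureTheory

noncomputable section

/-- The open unit strip in `ℂ`. -/
def openStrip : Set ℂ := {z | 0 < z.re ∧ z.re < 1}

/-- The closed unit strip in `ℂ`. -/
def closedStrip : Set ℂ := {z | 0 ≤ z.re ∧ z.re ≤ 1}

/-- The component of the Poisson kernel of the strip corresponding to the
boundary line `Re = 0`, evaluated at the boundary point `i t`. -/
def P0 (z : ℂ) (t : ℝ) : ℝ :=
  Real.sin (Real.pi * z.re) /
    (2 * (Real.cosh (Real.pi * (t - z.im)) - Real.cos (Real.pi * z.re)))

/-- The component of the Poisson kernel of the strip corresponding to the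
boundary line `Re = 1`, evaluated at the boundary point `1 + i t`. -/
def P1 (z : ℂ) (t : ℝ) : ℝ :=
  Real.sin (Real.pi * z.re) /
    (2 * (Real.cosh (Real.pi * (t - z.im)) + Real.cos (Real.pi * z.re)))


lemma one_add_sq_div_two_le_cosh (x : ℝ) : 1 + x ^ 2 / 2 ≤ Real.cosh x := by
  have h1 : Real.cosh x = 1 + 2 * Real.sinh (x / 2) ^ 2 := by
    have h2 := Real.cosh_two_mul (x / 2)
    have h3 := Real.cosh_sq (x / 2)
    rw [mul_div_cancel₀ x two_ne_zero] at h2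
    linarith
  have h4 : (x / 2) ^ 2 ≤ Real.sinh (x / 2) ^ 2 := by
    rw [sq_le_sq, Real.abs_sinh]
    exact Real.self_le_sinh_iff.2 (abs_nonneg _)
  rw [h1]
  linarith

lemma isOpen_openStrip : IsOpen openStrip :=
  (isOpen_lt continuous_const Complex.continuous_re).inter
    (isOpen_lt Complex.continuous_re continuous_const)

lemma openStrip_subset_closedStrip : openStrip ⊆ closedStrip := fun _ hz => ⟨hz.1.le, hz.2.le⟩

lemma cos_pi_re_lt_one {z : ℂ} (hz : z ∈ openStrip) : Real.cos (Real.pi * z.re) < 1 := by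
  have hpi := Real.pi_pos
  rw [← Real.cos_zero]
  apply Real.cos_lt_cos_of_nonneg_of_le_pi le_rfl
  · nlinarith [hz.2]
  · exact mul_pos hpi hz.1

lemma sin_pi_re_pos {z : ℂ} (hz : z ∈ openStrip) : 0 < Real.sin (Real.pi * z.re) := by
  have hpi := Real.pi_pos
  apply Real.sin_pos_of_pos_of_lt_pi
  · exact mul_pos hpi hz.1
  · nlinarith [hz.2]

lemma P0_denom_pos {z : ℂ} (hz : z ∈ openStrip) (t : ℝ) :
    0 < 2 * (Real.cosh (Real.pi * (t - z.im)) - Real.cos (Real.pi * z.re)) := by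
  linarith [cos_pi_re_lt_one hz, Real.one_le_cosh (Real.pi * (t - z.im))]

lemma P0_nonneg {z : ℂ} (hz : z ∈ openStrip) (t : ℝ) : 0 ≤ P0 z t :=
  div_nonneg (sin_pi_re_pos hz).le (P0_denom_pos hz t).le

lemma continuousOn_P0 : ContinuousOn (fun p : ℂ × ℝ => P0 p.1 p.2) (openStrip ×ˢ Set.univ) := by
  unfold P0
  refine ContinuousOn.div (by fun_prop) ?_ fun p hp => (P0_denom_pos hp.1 p.2).ne'
  have := Complex.continuous_im
  have := Complex.continuous_re
  have := Real.continuous_cosh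
  fun_prop

lemma continuous_P0 {z : ℂ} (hz : z ∈ openStrip) : Continuous (P0 z) := by
  have : ContinuousOn (fun t : ℝ => P0 z t) Set.univ :=
    continuousOn_P0.comp (f := fun t : ℝ => (z, t)) (by fun_prop) fun t _ => ⟨hz, trivial⟩
  exact continuousOn_univ.1 this

/-- On compact subsets of the strip the kernel is dominated by a multiple of `(1 + t ^ 2)⁻¹`. -/
lemma exists_P0_le {K : Set ℂ} (hK : IsCompact K) (hKS : K ⊆ openStrip) :
    ∃ C : ℝ, ∀ z ∈ K, ∀ t : ℝ, P0 z t ≤ C * (1 + t ^ 2)⁻¹ := by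
  rcases K.eq_empty_or_nonempty with rfl | hne
  · exact ⟨0, by simp⟩
  obtain ⟨a, haK, ha⟩ := hK.exists_isMaxOn (f := fun z : ℂ => Real.cos (Real.pi * z.re)) hne
    (by fun_prop)
  obtain ⟨b, hbK, hb⟩ := hK.exists_isMaxOn (f := fun z : ℂ => z.im ^ 2) hne (by fun_prop)
  set c := Real.cos (Real.pi * a.re) with hc
  set Y := b.im ^ 2 with hY
  have hc1 : c < 1 := cos_pi_re_lt_one (hKS haK)
  have hc2 : -1 ≤ c := Real.neg_one_le_cos _
  have hY0 : 0 ≤ Y := sq_nonneg _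
  refine ⟨2 * (1 + Y) / (1 - c), fun z hz t => ?_⟩
  have hza : Real.cos (Real.pi * z.re) ≤ c := ha hz
  have hzb : z.im ^ 2 ≤ Y := hb hz
  have hcosh := one_add_sq_div_two_le_cosh (Real.pi * (t - z.im))
  have hpi : 2 ≤ Real.pi ^ 2 := by nlinarith [Real.pi_gt_three]
  have hden : (1 - c) * (1 + (t - z.im) ^ 2) ≤
      2 * (Real.cosh (Real.pi * (t - z.im)) - Real.cos (Real.pi * z.re)) := by
    have : 2 * (t - z.im) ^ 2 ≤ (Real.pi * (t - z.im)) ^ 2 := by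
      rw [mul_pow]; gcongr
    nlinarith [sq_nonneg (t - z.im)]
  have ht : 1 + t ^ 2 ≤ 2 * (1 + Y) * (1 + (t - z.im) ^ 2) := by
    nlinarith [sq_nonneg (t - 2 * z.im), mul_nonneg hY0 (sq_nonneg (t - z.im))]
  unfold P0
  rw [← div_eq_mul_inv, div_div, div_le_div_iff₀ (P0_denom_pos (hKS hz) t)
    (mul_pos (by linarith) (by positivity))]
  have h1 : Real.sin (Real.pi * z.re) ≤ 1 := Real.sin_le_one _
  have h2 : 0 ≤ (1 - c) * (1 + t ^ 2) := mul_nonneg (by linarith) (by positivity)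
  calc _ ≤ 1 * ((1 - c) * (1 + t ^ 2)) := by gcongr
    _ ≤ (1 - c) * (2 * (1 + Y) * (1 + (t - z.im) ^ 2)) := by
      rw [one_mul]; exact mul_le_mul_of_nonneg_left ht (by linarith)
    _ = 2 * (1 + Y) * ((1 - c) * (1 + (t - z.im) ^ 2)) := by ring
    _ ≤ _ := by gcongr

lemma integrable_P0 {z : ℂ} (hz : z ∈ openStrip) : Integrable (P0 z) := by
  obtain ⟨C, hC⟩ := exists_P0_le (isCompact_singleton (x := z)) (by simpa using hz)
  refine (integrable_inv_one_add_sq.const_mul C).mono'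
    (continuous_P0 hz).aestronglyMeasurable (ae_of_all _ fun t => ?_)
  rw [Real.norm_of_nonneg (P0_nonneg hz t)]
  exact hC z rfl t

lemma sin_half_pos {z : ℂ} (hz : z ∈ openStrip) : 0 < Real.sin (Real.pi * z.re / 2) := by
  have hpi := Real.pi_pos
  apply Real.sin_pos_of_pos_of_lt_pi
  · exact div_pos (mul_pos hpi hz.1) two_pos
  · nlinarith [hz.2, hz.1]

/-- An explicit antiderivative of the kernel along the boundary line. -/
def P0Primitive (z : ℂ) (t : ℝ) : ℝ :=
  Real.pi⁻¹ * Real.arctan (Real.cos (Real.pi * z.re / 2) / Real.sin (Real.pi * z.re / 2) *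
    Real.tanh (Real.pi * (t - z.im) / 2))

lemma hasDerivAt_P0Primitive {z : ℂ} (hz : z ∈ openStrip) (t : ℝ) :
    HasDerivAt (P0Primitive z) (P0 z t) t := by
  have hs := sin_half_pos hz
  unfold P0Primitive P0
  have e1 : Real.pi * z.re = 2 * (Real.pi * z.re / 2) := by ring
  have e2 : Real.pi * (t - z.im) = 2 * (Real.pi * (t - z.im) / 2) := by ring
  have hlin : HasDerivAt (fun t : ℝ => Real.pi * (t - z.im) / 2) (Real.pi / 2) t := by
    simpa using (((hasDerivAt_id t).sub_const z.im).const_mul Real.pi).div_const 2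
  have hch := Real.cosh_pos (Real.pi * (t - z.im) / 2)
  have htanh : HasDerivAt (fun t : ℝ => Real.tanh (Real.pi * (t - z.im) / 2))
      (Real.pi / 2 / Real.cosh (Real.pi * (t - z.im) / 2) ^ 2) t := by
    have := (hlin.sinh).div (hlin.cosh) hch.ne'
    simp_rw [Real.tanh_eq_sinh_div_cosh]
    refine this.congr_deriv ?_
    congr 1
    linear_combination (Real.pi / 2) * Real.cosh_sq_sub_sinh_sq (Real.pi * (t - z.im) / 2)
  have := (htanh.const_mul (Real.cos (Real.pi * z.re / 2) / Real.sin (Real.pi * z.re / 2))).arctan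
  refine (this.const_mul Real.pi⁻¹).congr_deriv ?_
  rw [Real.tanh_eq_sinh_div_cosh]
  set a := Real.pi * z.re / 2
  set b := Real.pi * (t - z.im) / 2
  rw [e1, e2, Real.sin_two_mul, Real.cos_two_mul, Real.cosh_two_mul]
  have h1 := Real.sin_sq_add_cos_sq a
  have h2 := Real.cosh_sq_sub_sinh_sq b
  have hpi := Real.pi_ne_zero
  have hd : 0 < Real.sin a ^ 2 * Real.cosh b ^ 2 + Real.cos a ^ 2 * Real.sinh b ^ 2 := by
    positivity
  have hden : 2 * (Real.cosh b ^ 2 + Real.sinh b ^ 2 - (2 * Real.cos a ^ 2 - 1)) =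
      4 * (Real.sin a ^ 2 * Real.cosh b ^ 2 + Real.cos a ^ 2 * Real.sinh b ^ 2) := by
    have h3 : Real.cosh b ^ 2 = 1 + Real.sinh b ^ 2 := by linarith
    have h4 : Real.sin a ^ 2 = 1 - Real.cos a ^ 2 := by linarith
    rw [h3, h4]; ring
  rw [hden]
  have h5 : 1 + (Real.cos a / Real.sin a * (Real.sinh b / Real.cosh b)) ^ 2 =
      (Real.sin a ^ 2 * Real.cosh b ^ 2 + Real.cos a ^ 2 * Real.sinh b ^ 2) /
        (Real.sin a ^ 2 * Real.cosh b ^ 2) := by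
    field_simp
  rw [h5]
  field_simp
  norm_num

lemma tendsto_tanh_atTop : Tendsto Real.tanh atTop (𝓝 1) := by
  have h : Tendsto (fun x : ℝ => 1 - 2 * (Real.exp (2 * x) + 1)⁻¹) atTop (𝓝 (1 - 2 * 0)) := by
    refine tendsto_const_nhds.sub (Tendsto.const_mul _ (tendsto_inv_atTop_zero.comp ?_))
    exact tendsto_atTop_add_const_right _ _
      (Real.tendsto_exp_atTop.comp (tendsto_id.const_mul_atTop two_pos))
  simp only [mul_zero, sub_zero] at h
  refine h.congr fun x => ?_
  rw [Real.tanh_eq_sinh_div_cosh, Real.sinh_eq, Real.cosh_eq]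
  have h1 : Real.exp (2 * x) = Real.exp x * Real.exp x := by rw [← Real.exp_add]; ring_nf
  rw [h1, Real.exp_neg]
  have := Real.exp_pos x
  field_simp
  ring

lemma tendsto_tanh_atBot : Tendsto Real.tanh atBot (𝓝 (-1)) := by
  have := (tendsto_tanh_atTop.comp tendsto_neg_atBot_atTop).neg
  refine this.congr fun x => ?_
  simp [Real.tanh_neg]

lemma integral_P0 {z : ℂ} (hz : z ∈ openStrip) : ∫ t, P0 z t = 1 - z.re := by
  have hpi := Real.pi_pos
  set k := Real.cos (Real.pi * z.re / 2) / Real.sin (Real.pi * z.re / 2) with hk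
  have hk' : Real.arctan k = Real.pi / 2 - Real.pi * z.re / 2 := by
    rw [hk, ← Real.sin_pi_div_two_sub, ← Real.cos_pi_div_two_sub (Real.pi * z.re / 2),
      ← Real.tan_eq_sin_div_cos]
    apply Real.arctan_tan <;> nlinarith [hz.1, hz.2]
  have hlin : Tendsto (fun t : ℝ => Real.pi * (t - z.im) / 2) atTop atTop :=
    ((tendsto_atTop_add_const_right _ (-z.im) tendsto_id).const_mul_atTop hpi).atTop_div_const
      two_pos
  have hlin' : Tendsto (fun t : ℝ => Real.pi * (t - z.im) / 2) atBot atBot :=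
    ((tendsto_atBot_add_const_right _ (-z.im) tendsto_id).const_mul_atBot hpi).atBot_div_const
      two_pos
  have key : ∀ {l : Filter ℝ} {m : ℝ},
      Tendsto (fun t : ℝ => Real.tanh (Real.pi * (t - z.im) / 2)) l (𝓝 m) →
      Tendsto (P0Primitive z) l (𝓝 (Real.pi⁻¹ * Real.arctan (k * m))) := fun h =>
    ((Real.continuous_arctan.tendsto _).comp (h.const_mul k)).const_mul _
  rw [integral_of_hasDerivAt_of_tendsto (hasDerivAt_P0Primitive hz) (integrable_P0 hz)
    (key (tendsto_tanh_atBot.comp hlin')) (key (tendsto_tanh_atTop.comp hlin))]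
  rw [mul_neg, mul_one, Real.arctan_neg, hk']
  field_simp
  ring

lemma P0_eq_re_cot {z : ℂ} (hz : z ∈ openStrip) (t : ℝ) :
    P0 z t = (Complex.cos (Real.pi * (z - t * Complex.I) / 2) /
      (2 * Complex.sin (Real.pi * (z - t * Complex.I) / 2))).re := by
  have hs := sin_half_pos hz
  have hw : (Real.pi * (z - t * Complex.I) / 2 : ℂ) =
      ((Real.pi * z.re / 2 : ℝ) : ℂ) + ((Real.pi * (z.im - t) / 2 : ℝ) : ℂ) * Complex.I := by
    apply Complex.ext <;> simp
  have e1 : Real.pi * z.re = 2 * (Real.pi * z.re / 2) := by ring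
  have e2 : Real.pi * (t - z.im) = -(2 * (Real.pi * (z.im - t) / 2)) := by ring
  rw [hw, P0]
  set a := Real.pi * z.re / 2
  set b := Real.pi * (z.im - t) / 2
  rw [e1, e2, Real.cosh_neg, Real.sin_two_mul, Real.cos_two_mul, Real.cosh_two_mul]
  rw [Complex.cos_add_mul_I, Complex.sin_add_mul_I, ← Complex.ofReal_cos, ← Complex.ofReal_sin,
    ← Complex.ofReal_cosh, ← Complex.ofReal_sinh, Complex.div_re]
  simp only [Complex.normSq_apply, Complex.mul_re, Complex.mul_im, Complex.add_re, Complex.add_im,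
    Complex.sub_re, Complex.sub_im, Complex.ofReal_re, Complex.ofReal_im, Complex.I_re,
    Complex.I_im, Complex.re_ofNat, Complex.im_ofNat]
  have h1 := Real.sin_sq_add_cos_sq a
  have h2 := Real.cosh_sq_sub_sinh_sq b
  have hch := Real.cosh_pos b
  have h3 : Real.cosh b ^ 2 = 1 + Real.sinh b ^ 2 := by linarith
  have h4 : Real.cos a ^ 2 = 1 - Real.sin a ^ 2 := by linarith
  have hd : 0 < Real.sin a ^ 2 + Real.sinh b ^ 2 := by positivity
  have hden : 2 * (Real.cosh b ^ 2 + Real.sinh b ^ 2 - (2 * Real.cos a ^ 2 - 1)) =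
      4 * (Real.sin a ^ 2 + Real.sinh b ^ 2) := by
    rw [h3, h4]; ring
  rw [hden, ← add_div, div_eq_div_iff (by positivity)]
  · ring_nf
    simp only [h3, h4, show Real.cos a ^ 3 = Real.cos a * Real.cos a ^ 2 by ring]
    ring
  · ring_nf
    rw [h3, h4]
    ring_nf
    positivity

/-- The kernel has the mean value property in its first argument. -/
lemma circleAverage_P0 {z : ℂ} {r : ℝ} (hr : 0 < r) (hz : Metric.closedBall z r ⊆ openStrip)
    (t : ℝ) : Real.circleAverage (fun w => P0 w t) z r = P0 z t := by
  have hF : DiffContOnCl ℂ (fun w : ℂ => Complex.cos (Real.pi * (w - t * Complex.I) / 2) /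
      (2 * Complex.sin (Real.pi * (w - t * Complex.I) / 2))) (Metric.ball z |r|) := by
    rw [abs_of_pos hr]
    refine DifferentiableOn.diffContOnCl_ball (U := openStrip) (fun w hw => ?_) hz
    refine (DifferentiableAt.div (by fun_prop) (by fun_prop) ?_).differentiableWithinAt
    rw [mul_ne_zero_iff]
    refine ⟨two_ne_zero, fun h0 => ?_⟩
    obtain ⟨k, hk⟩ := Complex.sin_eq_zero_iff.1 h0
    have hre := congrArg Complex.re hk
    simp at hre
    have hpi := Real.pi_pos
    have h1 : w.re / 2 = k := by
      field_simp at hre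
      linarith
    have h2 : (0 : ℝ) < k := by linarith [hw.1]
    have h3 : (k : ℝ) < 1 := by linarith [hw.2]
    norm_cast at h2 h3
    omega
  have hint : CircleIntegrable (fun w : ℂ => Complex.cos (Real.pi * (w - t * Complex.I) / 2) /
      (2 * Complex.sin (Real.pi * (w - t * Complex.I) / 2))) z r := by
    refine ContinuousOn.circleIntegrable hr.le ?_
    have := hF.continuousOn_ball
    rw [abs_of_pos hr] at this
    exact this.mono Metric.sphere_subset_closedBall
  have h := Complex.reCLM.circleAverage_comp_comm hint
  rw [hF.circleAverage] at h
  have hz0 : z ∈ openStrip := hz (Metric.mem_closedBall_self hr.le)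
  rw [P0_eq_re_cot hz0, ← Complex.reCLM_apply, ← h]
  refine Real.circleAverage_congr_sphere fun w hw => ?_
  rw [abs_of_pos hr] at hw
  exact P0_eq_re_cot (hz (Metric.sphere_subset_closedBall hw)) t

/-- The contribution to the Poisson integral of boundary values `f` on the line `Re = 0`. -/
def poissonIntegral (f : ℝ → ℝ) (z : ℂ) : ℝ := ∫ t, f t * P0 z t

section PoissonIntegral

variable {f : ℝ → ℝ} {B : ℝ}

lemma norm_mul_P0_le (hB : ∀ t, ‖f t‖ ≤ B) {z : ℂ} (hz : z ∈ openStrip) {t C : ℝ}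
    (hC : P0 z t ≤ C) : ‖f t * P0 z t‖ ≤ B * C := by
  rw [norm_mul, Real.norm_of_nonneg (P0_nonneg hz t)]
  exact mul_le_mul (hB t) hC (P0_nonneg hz t) ((norm_nonneg _).trans (hB t))

lemma integrable_mul_P0 (hf : Continuous f) (hB : ∀ t, ‖f t‖ ≤ B) {z : ℂ} (hz : z ∈ openStrip) :
    Integrable fun t => f t * P0 z t :=
  (integrable_P0 hz).bdd_mul hf.aestronglyMeasurable (ae_of_all _ hB)

lemma poissonIntegral_nonneg (hf0 : ∀ t, 0 ≤ f t) {z : ℂ} (hz : z ∈ openStrip) :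
    0 ≤ poissonIntegral f z :=
  integral_nonneg fun t => mul_nonneg (hf0 t) (P0_nonneg hz t)

lemma continuousOn_poissonIntegral (hf : Continuous f) (hB : ∀ t, ‖f t‖ ≤ B) :
    ContinuousOn (poissonIntegral f) openStrip := by
  intro z hz
  obtain ⟨r, hr, hrS⟩ := Metric.nhds_basis_closedBall.mem_iff.1 (isOpen_openStrip.mem_nhds hz)
  obtain ⟨C, hC⟩ := exists_P0_le (isCompact_closedBall z r) hrS
  have : ContinuousOn (poissonIntegral f) (Metric.closedBall z r) := by
    refine continuousOn_of_dominated (bound := fun t => B * (C * (1 + t ^ 2)⁻¹))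
      (fun w hw => (hf.mul (continuous_P0 (hrS hw))).aestronglyMeasurable)
      (fun w hw => ae_of_all _ fun t => norm_mul_P0_le hB (hrS hw) (hC w hw t))
      ((integrable_inv_one_add_sq.const_mul C).const_mul B) (ae_of_all _ fun t => ?_)
    exact continuousOn_const.mul (continuousOn_P0.comp (f := fun w : ℂ => (w, t)) (by fun_prop)
      fun w hw => ⟨hrS hw, trivial⟩)
  exact (this.continuousAt (Metric.closedBall_mem_nhds z hr)).continuousWithinAt

lemma circleAverage_poissonIntegral (hf : Continuous f) (hB : ∀ t, ‖f t‖ ≤ B) {z : ℂ} {r : ℝ}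
    (hr : 0 < r) (hz : Metric.closedBall z r ⊆ openStrip) :
    Real.circleAverage (poissonIntegral f) z r = poissonIntegral f z := by
  have hmem : ∀ θ : ℝ, circleMap z r θ ∈ Metric.closedBall z r :=
    fun θ => circleMap_mem_closedBall z hr.le θ
  obtain ⟨C, hC⟩ := exists_P0_le (isCompact_closedBall z r) hz
  have hcont : Continuous fun p : ℝ × ℝ => f p.2 * P0 (circleMap z r p.1) p.2 := by
    refine (hf.comp continuous_snd).mul ?_
    rw [← continuousOn_univ]
    exact continuousOn_P0.comp (f := fun p : ℝ × ℝ => (circleMap z r p.1, p.2))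
      (((continuous_circleMap z r).comp continuous_fst).prodMk continuous_snd).continuousOn
      fun p _ => ⟨hz (hmem p.1), trivial⟩
  have hint : Integrable (Function.uncurry fun θ t : ℝ => f t * P0 (circleMap z r θ) t)
      ((volume.restrict (Set.uIoc 0 (2 * Real.pi))).prod volume) := by
    have : IsFiniteMeasure (volume.restrict (Set.uIoc 0 (2 * Real.pi))) := by
      unfold Set.uIoc; infer_instance
    have hb : Integrable (fun p : ℝ × ℝ => (1 : ℝ) * (B * (C * (1 + p.2 ^ 2)⁻¹)))
        ((volume.restrict (Set.uIoc 0 (2 * Real.pi))).prod volume) :=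
      Integrable.mul_prod (f := fun _ : ℝ => (1 : ℝ)) (integrable_const 1)
        ((integrable_inv_one_add_sq.const_mul C).const_mul B)
    refine hb.mono' hcont.aestronglyMeasurable (ae_of_all _ fun p => ?_)
    rw [one_mul]
    exact norm_mul_P0_le hB (hz (hmem p.1)) (hC _ (hmem p.1) p.2)
  unfold poissonIntegral
  rw [Real.circleAverage_def, intervalIntegral_integral_swap hint, ← integral_smul]
  refine integral_congr_ae (ae_of_all _ fun t => ?_)
  have := circleAverage_P0 hr hz t
  rw [Real.circleAverage_def] at this
  simp only [intervalIntegral.integral_const_mul, smul_eq_mul] at this ⊢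
  rw [mul_left_comm, this]

/-- Lower semicontinuity of the Poisson integral at the boundary line `Re = 0`. -/
lemma eventually_lt_poissonIntegral (hf : Continuous f) (hB : ∀ t, ‖f t‖ ≤ B)
    (hf0 : ∀ t, 0 ≤ f t) {w : ℂ} (hw : w.re = 0) {c : ℝ} (hc : c < f w.im) :
    ∀ᶠ z in 𝓝[openStrip] w, c < poissonIntegral f z := by
  have hpi := Real.pi_pos
  obtain ⟨c', hcc', hc'⟩ := exists_between hc
  obtain ⟨δ, hδ, hδf⟩ := Metric.nhds_basis_closedBall.eventually_iff.1
    (hf.continuousAt.eventually (lt_mem_nhds hc'))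
  have hre : Tendsto (fun z : ℂ => Real.pi * z.re / 2) (𝓝[openStrip] w) (𝓝 0) := by
    have : Continuous fun z : ℂ => Real.pi * z.re / 2 := by fun_prop
    simpa [hw] using (this.tendsto w).mono_left nhdsWithin_le_nhds
  have hsin : Tendsto (fun z : ℂ => Real.sin (Real.pi * z.re / 2)) (𝓝[openStrip] w) (𝓝[>] 0) := by
    refine tendsto_nhdsWithin_iff.2 ⟨?_, eventually_mem_nhdsWithin.mono fun z hz => sin_half_pos hz⟩
    simpa [Function.comp_def] using (Real.continuous_sin.tendsto 0).comp hre
  have hcos : Tendsto (fun z : ℂ => Real.cos (Real.pi * z.re / 2)) (𝓝[openStrip] w) (𝓝 1) := by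
    simpa [Function.comp_def] using (Real.continuous_cos.tendsto 0).comp hre
  have hcot : Tendsto (fun z : ℂ => Real.cos (Real.pi * z.re / 2) / Real.sin (Real.pi * z.re / 2))
      (𝓝[openStrip] w) atTop := by
    simp_rw [div_eq_mul_inv]
    exact hcos.pos_mul_atTop one_pos (tendsto_inv_nhdsGT_zero.comp hsin)
  have htanh : ∀ a : ℝ, Tendsto (fun z : ℂ => Real.tanh (Real.pi * (w.im + a - z.im) / 2))
      (𝓝[openStrip] w) (𝓝 (Real.tanh (Real.pi * a / 2))) := by
    intro a
    have : Continuous fun z : ℂ => Real.tanh (Real.pi * (w.im + a - z.im) / 2) := by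
      simp_rw [Real.tanh_eq_sinh_div_cosh]
      refine Continuous.div ?_ ?_ fun z => (Real.cosh_pos _).ne'
      · exact Real.continuous_sinh.comp (by fun_prop)
      · exact Real.continuous_cosh.comp (by fun_prop)
    simpa using (this.tendsto w).mono_left nhdsWithin_le_nhds
  have htp : 0 < Real.tanh (Real.pi * δ / 2) := by
    rw [Real.tanh_eq_sinh_div_cosh]
    exact div_pos (Real.sinh_pos_iff.2 (by positivity)) (Real.cosh_pos _)
  have h1 : Tendsto (fun z => P0Primitive z (w.im + δ)) (𝓝[openStrip] w)
      (𝓝 (Real.pi⁻¹ * (Real.pi / 2))) :=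
    ((Real.tendsto_arctan_atTop.mono_right nhdsWithin_le_nhds).comp
      (hcot.atTop_mul_pos htp (htanh δ))).const_mul _
  have h2 : Tendsto (fun z => P0Primitive z (w.im + -δ)) (𝓝[openStrip] w)
      (𝓝 (Real.pi⁻¹ * (-(Real.pi / 2)))) := by
    refine ((Real.tendsto_arctan_atBot.mono_right nhdsWithin_le_nhds).comp
      (hcot.atTop_mul_neg ?_ (htanh (-δ)))).const_mul _
    rwa [mul_neg, neg_div, Real.tanh_neg, neg_lt_zero]
  have h3 := (h1.sub h2).const_mul c'
  have hone : c' * (Real.pi⁻¹ * (Real.pi / 2) - Real.pi⁻¹ * (-(Real.pi / 2))) = c' := by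
    field_simp; ring
  rw [hone] at h3
  filter_upwards [h3.eventually (lt_mem_nhds hcc'), eventually_mem_nhdsWithin] with z hz hzS
  refine hz.trans_le ?_
  have hP := continuous_P0 hzS
  have hle : w.im + -δ ≤ w.im + δ := by linarith
  rw [← intervalIntegral.integral_eq_sub_of_hasDerivAt
    (fun t _ => hasDerivAt_P0Primitive hzS t) (hP.intervalIntegrable _ _),
    ← intervalIntegral.integral_const_mul]
  calc _ ≤ ∫ t in (w.im + -δ)..(w.im + δ), f t * P0 z t := by
        refine intervalIntegral.integral_mono_on hle ((hP.const_mul c').intervalIntegrable _ _)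
          ((hf.mul hP).intervalIntegrable _ _) fun t ht => ?_
        refine mul_le_mul_of_nonneg_right (hδf ?_).le (P0_nonneg hzS t)
        rw [Real.closedBall_eq_Icc]
        exact ⟨by linarith [ht.1], ht.2⟩
    _ ≤ _ := by
        rw [intervalIntegral.integral_of_le hle]
        exact setIntegral_le_integral (integrable_mul_P0 hf hB hzS)
          (ae_of_all _ fun t => mul_nonneg (hf0 t) (P0_nonneg hzS t))

end PoissonIntegral

/-- A continuous function with the sub-mean value property that exceeds a given level only on a
compact set does not exceed it at all. -/
lemma subMeanValue_lt_of_isCompact {W : ℂ → ℝ} {U : Set ℂ} (hU : IsOpen U)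
    (hW : ContinuousOn W U)
    (hsub : ∀ z ∈ U, ∀ r : ℝ, 0 < r → Metric.closedBall z r ⊆ U →
      W z ≤ Real.circleAverage W z r)
    {η : ℝ} (hA : IsCompact {z ∈ U | η ≤ W z}) {z : ℂ} (hz : z ∈ U) : W z < η := by
  by_contra! hlt
  obtain ⟨a, haA, ha⟩ := hA.exists_isMaxOn ⟨z, hz, hlt⟩ (hW.mono fun x hx => hx.1)
  have hmax : ∀ x ∈ U, W x ≤ W a := fun x hx => by
    by_cases h : η ≤ W x
    · exact ha ⟨hx, h⟩
    · exact (not_le.1 h).le.trans haA.2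
  have hM : IsCompact {z ∈ U | W a ≤ W z} := by
    have h1 : IsClosed ({z ∈ U | η ≤ W z} ∩ W ⁻¹' Set.Ici (W a)) :=
      (hW.mono fun x hx => hx.1).preimage_isClosed_of_isClosed hA.isClosed isClosed_Ici
    convert hA.inter_left h1 using 1
    ext x
    constructor
    · exact fun hx => ⟨⟨⟨hx.1, haA.2.trans hx.2⟩, hx.2⟩, hx.1, haA.2.trans hx.2⟩
    · exact fun hx => ⟨hx.2.1, hx.1.2⟩
  obtain ⟨b, hbM, hb⟩ := hM.exists_isMinOn ⟨a, haA.1, le_rfl⟩ Complex.continuous_re.continuousOn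
  obtain ⟨r, hr, hrU⟩ := Metric.nhds_basis_closedBall.mem_iff.1 (hU.mem_nhds hbM.1)
  have hmem : ∀ θ, circleMap b r θ ∈ U := fun θ => hrU (circleMap_mem_closedBall b hr.le θ)
  have hcont : Continuous fun θ => W (circleMap b r θ) := by
    rw [← continuousOn_univ]
    exact hW.comp (continuous_circleMap b r).continuousOn fun θ _ => hmem θ
  have hleft : W (circleMap b r Real.pi) < W a := by
    by_contra! h
    have h2 : b.re ≤ (circleMap b r Real.pi).re := hb (a := circleMap b r Real.pi) ⟨hmem _, h⟩
    simp [circleMap] at h2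
    linarith
  have hpi := Real.pi_pos
  have hlt := intervalIntegral.integral_lt_integral_of_continuousOn_of_le_of_exists_lt
    (a := 0) (b := 2 * Real.pi) (by positivity) hcont.continuousOn
    (continuousOn_const (c := W a)) (fun θ _ => hmax _ (hmem θ))
    ⟨Real.pi, ⟨hpi.le, by linarith⟩, hleft⟩
  have hmean := hsub b hbM.1 r hr hrU
  rw [Real.circleAverage_def, smul_eq_mul] at hmean
  rw [intervalIntegral.integral_const, smul_eq_mul, sub_zero] at hlt
  have : (2 * Real.pi)⁻¹ * ∫ θ in (0 : ℝ)..2 * Real.pi, W (circleMap b r θ) < W a := by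
    rw [inv_mul_lt_iff₀ (by positivity)]
    exact hlt
  linarith [hbM.2]

/-- The reflection of the strip interchanging its two boundary lines. -/
def stripReflection (z : ℂ) : ℂ := 1 - (starRingEnd ℂ) z

@[simp] lemma stripReflection_re (z : ℂ) : (stripReflection z).re = 1 - z.re := by
  simp [stripReflection]

@[simp] lemma stripReflection_im (z : ℂ) : (stripReflection z).im = z.im := by
  simp [stripReflection]

lemma continuous_stripReflection : Continuous stripReflection :=
  continuous_const.sub Complex.continuous_conj

lemma stripReflection_stripReflection (z : ℂ) : stripReflection (stripReflection z) = z := by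
  apply Complex.ext <;> simp

lemma stripReflection_mem_openStrip {z : ℂ} (hz : z ∈ openStrip) :
    stripReflection z ∈ openStrip := by
  constructor <;> simp [hz.1, hz.2]

lemma dist_stripReflection (z w : ℂ) : dist (stripReflection z) (stripReflection w) = dist z w := by
  rw [stripReflection, stripReflection, dist_sub_left, Complex.dist_conj_conj]

lemma P1_eq_P0_stripReflection (z : ℂ) (t : ℝ) : P1 z t = P0 (stripReflection z) t := by
  simp only [P0, P1, stripReflection_re, stripReflection_im, mul_sub, mul_one, Real.sin_pi_sub,
    Real.cos_pi_sub]
  ring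

lemma circleAverage_comp_stripReflection (g : ℂ → ℝ) (z : ℂ) (r : ℝ) :
    Real.circleAverage (fun w => g (stripReflection w)) z r =
      Real.circleAverage g (stripReflection z) r := by
  have h : ∀ θ : ℝ, stripReflection (circleMap z r θ) =
      circleMap (stripReflection z) r (Real.pi - θ) := by
    intro θ
    apply Complex.ext <;>
    simp [circleMap, stripReflection, Complex.exp_re, Complex.exp_im] <;> ring
  have hper : Function.Periodic (fun θ => g (circleMap (stripReflection z) r θ)) (2 * Real.pi) :=
    fun θ => by simp only [periodic_circleMap (stripReflection z) r θ]
  have := hper.intervalIntegral_add_eq (-Real.pi) 0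
  rw [Real.circleAverage_def, Real.circleAverage_def]
  simp_rw [h]
  rw [intervalIntegral.integral_comp_sub_left (fun θ => g (circleMap (stripReflection z) r θ))]
  rw [zero_add, show -Real.pi + 2 * Real.pi = Real.pi by ring] at this
  rw [show Real.pi - 2 * Real.pi = -Real.pi by ring, sub_zero, this]

lemma circleAverage_re_cos (z : ℂ) (r : ℝ) :
    Real.circleAverage (fun w : ℂ => (Complex.cos (w - 1 / 2)).re) z r =
      (Complex.cos (z - 1 / 2)).re := by
  have hd : Differentiable ℂ fun w : ℂ => Complex.cos (w - 1 / 2) := by fun_prop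
  have h := Complex.reCLM.circleAverage_comp_comm
    (hd.continuous.continuousOn.circleIntegrable' (c := z) (R := r))
  rw [hd.diffContOnCl.circleAverage] at h
  exact h

lemma re_cos_eq (z : ℂ) :
    (Complex.cos (z - 1 / 2)).re = Real.cos (z.re - 1 / 2) * Real.cosh z.im := by
  have : z - 1 / 2 = ((z.re - 1 / 2 : ℝ) : ℂ) + (z.im : ℂ) * Complex.I := by
    apply Complex.ext <;> simp
  rw [this]
  generalize z.re - 1 / 2 = a
  rw [Complex.cos_add_mul_I, ← Complex.ofReal_cos, ← Complex.ofReal_sin,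
    ← Complex.ofReal_cosh, ← Complex.ofReal_sinh]
  simp [Complex.cos_ofReal_re]

lemma half_mul_cosh_le_re_cos {z : ℂ} (hz : z ∈ closedStrip) :
    1 / 2 * Real.cosh z.im ≤ (Complex.cos (z - 1 / 2)).re := by
  rw [re_cos_eq]
  refine mul_le_mul_of_nonneg_right ?_ (Real.cosh_pos _).le
  have := Real.one_sub_sq_div_two_le_cos (x := z.re - 1 / 2)
  nlinarith [hz.1, hz.2]

lemma isClosed_closedStrip : IsClosed closedStrip :=
  (isClosed_le continuous_const Complex.continuous_re).inter
    (isClosed_le Complex.continuous_re continuous_const)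

/-- Maximum principle in the strip for functions bounded above. -/
lemma nonpos_of_subMeanValue_openStrip {v : ℂ → ℝ} (hv : ContinuousOn v openStrip)
    {B : ℝ} (hB : ∀ z ∈ openStrip, v z ≤ B)
    (hsub : ∀ z ∈ openStrip, ∀ r : ℝ, 0 < r → Metric.closedBall z r ⊆ openStrip →
      v z ≤ Real.circleAverage v z r)
    (hbd : ∀ w ∈ closedStrip, w ∉ openStrip → ∀ η > 0, ∀ᶠ z in 𝓝[openStrip] w, v z < η)
    {z : ℂ} (hz : z ∈ openStrip) : v z ≤ 0 := by
  set g : ℂ → ℝ := fun w => (Complex.cos (w - 1 / 2)).re with hg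
  have hgc : Continuous g := Complex.continuous_re.comp (by fun_prop)
  have hglow : ∀ w ∈ closedStrip, 1 / 2 * Real.cosh w.im ≤ g w := fun w hw =>
    half_mul_cosh_le_re_cos hw
  have hgpos : ∀ w ∈ closedStrip, 0 < g w := fun w hw =>
    (mul_pos one_half_pos (Real.cosh_pos _)).trans_le (hglow w hw)
  by_contra! hpos
  have hgz := hgpos z (openStrip_subset_closedStrip hz)
  set ε := v z / (2 * g z) with hε
  have hε0 : 0 < ε := by positivity
  set η := v z / 2 with hη
  have hη0 : 0 < η := by positivity
  have hWc : ContinuousOn (fun w => v w - ε * g w) openStrip :=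
    hv.sub (hgc.const_mul ε).continuousOn
  have hA : IsCompact {w ∈ openStrip | η ≤ v w - ε * g w} := by
    set A := {w ∈ openStrip | η ≤ v w - ε * g w} with hAdef
    apply Metric.isCompact_of_isClosed_isBounded
    · refine isClosed_of_closure_subset fun w hw => ?_
      have hwc : w ∈ closedStrip := closure_minimal
        (fun x hx => openStrip_subset_closedStrip hx.1) isClosed_closedStrip hw
      have hfr : ∃ᶠ x in 𝓝[openStrip] w, η ≤ v x - ε * g x := by
        rw [frequently_nhdsWithin_iff]
        exact (mem_closure_iff_frequently.1 hw).mono fun x hx => ⟨hx.2, hx.1⟩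
      by_cases hwo : w ∈ openStrip
      · refine ⟨hwo, ?_⟩
        by_contra! hlt
        exact hfr (((hWc w hwo).eventually (gt_mem_nhds hlt)).mono fun x hx => not_le.2 hx)
      · refine absurd hfr (not_frequently.2 ?_)
        filter_upwards [hbd w hwc hwo η hη0, eventually_mem_nhdsWithin] with x hx hxS
        have := mul_pos hε0 (hgpos x (openStrip_subset_closedStrip hxS))
        linarith
    · refine (Metric.isBounded_closedBall (x := (0 : ℂ)) (r := 1 + 2 * B / ε)).subset fun w hw => ?_
      rw [mem_closedBall_zero_iff]
      refine (Complex.norm_le_abs_re_add_abs_im w).trans (add_le_add ?_ ?_)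
      · rw [abs_of_pos hw.1.1]; exact hw.1.2.le
      · have h1 := hglow w (openStrip_subset_closedStrip hw.1)
        have h2 := one_add_sq_div_two_le_cosh w.im
        have h3 : ε * g w ≤ B := by linarith [hw.2, hB w hw.1]
        have h4 : |w.im| ≤ Real.cosh w.im := by nlinarith [sq_nonneg (|w.im| - 1), sq_abs w.im]
        rw [le_div_iff₀ hε0]
        nlinarith
  have hlt := subMeanValue_lt_of_isCompact isOpen_openStrip hWc (fun w hw r hr hball => ?_) hA hz
  · have : ε * g z = v z / 2 := by rw [hε]; field_simp
    simp only [this] at hlt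
    linarith
  · have hvi : CircleIntegrable v w r :=
      (hv.mono (Metric.sphere_subset_closedBall.trans hball)).circleIntegrable hr.le
    have hgi : CircleIntegrable (fun x => ε * g x) w r :=
      (hgc.const_mul ε).continuousOn.circleIntegrable hr.le
    have hgm : Real.circleAverage (fun x => ε * g x) w r = ε * g w := by
      have := Real.circleAverage_fun_smul (a := ε) (f := g) (c := w) (R := r)
      simp only [smul_eq_mul] at this
      rw [this, circleAverage_re_cos]
    rw [Real.circleAverage_fun_sub hvi hgi, hgm]
    exact sub_le_sub_right (hsub w hw r hr hball) _

/-- A continuous, bounded, nonnegative function on the closed strip which is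
subharmonic (satisfies the sub-mean value inequality) on the open strip is
dominated by the Poisson integral of its boundary values; moreover the Poisson
kernel components integrate to `1 - Re z` and `Re z` respectively. -/
theorem subharmonic_poisson_bound_strip (u : ℂ → ℝ)
    (hcont : ContinuousOn u closedStrip)
    (hbdd : ∃ B : ℝ, ∀ z ∈ closedStrip, u z ≤ B)
    (hnonneg : ∀ z ∈ closedStrip, 0 ≤ u z)
    (hsub : ∀ z ∈ openStrip, ∀ r : ℝ, 0 < r →
      Metric.closedBall z r ⊆ openStrip →
      u z ≤ (2 * Real.pi)⁻¹ *
        ∫ t in (0 : ℝ)..(2 * Real.pi), u (z + (r : ℂ) * Complex.exp (t * Complex.I))) :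
    ∀ z ∈ openStrip,
      (u z ≤ (∫ t : ℝ, u (Complex.I * t) * P0 z t) +
        ∫ t : ℝ, u (1 + Complex.I * t) * P1 z t) ∧
      (∫ t : ℝ, P0 z t) = 1 - z.re ∧ (∫ t : ℝ, P1 z t) = z.re := by
  obtain ⟨B, hB⟩ := hbdd
  set f₀ : ℝ → ℝ := fun t => u (Complex.I * t) with hf₀
  set f₁ : ℝ → ℝ := fun t => u (1 + Complex.I * t) with hf₁
  have hmem₀ : ∀ t : ℝ, Complex.I * t ∈ closedStrip := fun t => by simp [closedStrip]
  have hmem₁ : ∀ t : ℝ, 1 + Complex.I * t ∈ closedStrip := fun t => by simp [closedStrip]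
  have hc₀ : Continuous f₀ := continuousOn_univ.1
    (hcont.comp (f := fun t : ℝ => Complex.I * t) (by fun_prop) fun t _ => hmem₀ t)
  have hc₁ : Continuous f₁ := continuousOn_univ.1
    (hcont.comp (f := fun t : ℝ => 1 + Complex.I * t) (by fun_prop) fun t _ => hmem₁ t)
  have hn₀ : ∀ t, 0 ≤ f₀ t := fun t => hnonneg _ (hmem₀ t)
  have hn₁ : ∀ t, 0 ≤ f₁ t := fun t => hnonneg _ (hmem₁ t)
  have hB₀ : ∀ t, ‖f₀ t‖ ≤ B := fun t => by
    rw [Real.norm_of_nonneg (hn₀ t)]; exact hB _ (hmem₀ t)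
  have hB₁ : ∀ t, ‖f₁ t‖ ≤ B := fun t => by
    rw [Real.norm_of_nonneg (hn₁ t)]; exact hB _ (hmem₁ t)
  have hk₀ := continuousOn_poissonIntegral hc₀ hB₀
  have hk₁ : ContinuousOn (fun w => poissonIntegral f₁ (stripReflection w)) openStrip :=
    (continuousOn_poissonIntegral hc₁ hB₁).comp continuous_stripReflection.continuousOn
      fun w hw => stripReflection_mem_openStrip hw
  have hpos₀ : ∀ w ∈ openStrip, 0 ≤ poissonIntegral f₀ w :=
    fun w hw => poissonIntegral_nonneg hn₀ hw
  have hpos₁ : ∀ w ∈ openStrip, 0 ≤ poissonIntegral f₁ (stripReflection w) :=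
    fun w hw => poissonIntegral_nonneg hn₁ (stripReflection_mem_openStrip hw)
  have huc : ContinuousOn u openStrip := hcont.mono openStrip_subset_closedStrip
  intro z hz
  refine ⟨?_, integral_P0 hz, ?_⟩
  swap
  · simp_rw [P1_eq_P0_stripReflection]
    rw [integral_P0 (stripReflection_mem_openStrip hz), stripReflection_re, sub_sub_cancel]
  simp_rw [P1_eq_P0_stripReflection]
  change u z ≤ poissonIntegral f₀ z + poissonIntegral f₁ (stripReflection z)
  have key := nonpos_of_subMeanValue_openStrip
    (v := fun w => u w - (poissonIntegral f₀ w + poissonIntegral f₁ (stripReflection w))) (B := B)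
    (huc.sub (hk₀.add hk₁)) (fun w hw => ?_) (fun w hw r hr hball => ?_)
    (fun w hw hwo η hη => ?_) hz
  · exact sub_nonpos.1 key
  · linarith [hB w (openStrip_subset_closedStrip hw), hpos₀ w hw, hpos₁ w hw]
  · have hsph : Metric.sphere w r ⊆ openStrip := Metric.sphere_subset_closedBall.trans hball
    have hball' : Metric.closedBall (stripReflection w) r ⊆ openStrip := fun x hx => by
      rw [← stripReflection_stripReflection x]
      refine stripReflection_mem_openStrip (hball ?_)
      rwa [Metric.mem_closedBall, ← dist_stripReflection, stripReflection_stripReflection]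
    have hi₀ := (hk₀.mono hsph).circleIntegrable hr.le
    have hi₁ := (hk₁.mono hsph).circleIntegrable hr.le
    have hi : CircleIntegrable
        (fun x => poissonIntegral f₀ x + poissonIntegral f₁ (stripReflection x)) w r := hi₀.add hi₁
    rw [Real.circleAverage_fun_sub ((huc.mono hsph).circleIntegrable hr.le) hi,
      Real.circleAverage_fun_add hi₀ hi₁, circleAverage_poissonIntegral hc₀ hB₀ hr hball,
      circleAverage_comp_stripReflection, circleAverage_poissonIntegral hc₁ hB₁ hr hball']
    exact sub_le_sub_right (hsub w hw r hr hball) _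
  · have hu : ∀ᶠ x in 𝓝[openStrip] w, u x < u w + η / 2 :=
      ((hcont w hw).mono openStrip_subset_closedStrip).eventually
        (gt_mem_nhds (by linarith))
    rcases hw.1.eq_or_lt with h0 | h0
    · have hfw : f₀ w.im = u w := congrArg u (by apply Complex.ext <;> simp [← h0])
      filter_upwards [hu, eventually_mem_nhdsWithin, eventually_lt_poissonIntegral hc₀ hB₀ hn₀
        h0.symm (c := u w - η / 2) (by rw [hfw]; linarith)] with x hx hxS hxP
      linarith [hpos₁ x hxS]
    · have h1 : w.re = 1 := le_antisymm hw.2 (not_lt.1 fun h => hwo ⟨h0, h⟩)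
      have hfw : f₁ w.im = u w := congrArg u (by apply Complex.ext <;> simp [h1])
      have hrefl : Tendsto stripReflection (𝓝[openStrip] w) (𝓝[openStrip] (stripReflection w)) :=
        (continuous_stripReflection.continuousWithinAt).tendsto_nhdsWithin
          fun x hx => stripReflection_mem_openStrip hx
      have hP := hrefl.eventually (eventually_lt_poissonIntegral hc₁ hB₁ hn₁
        (w := stripReflection w) (by simp [h1]) (c := u w - η / 2)
        (by rw [stripReflection_im, hfw]; linarith))
      filter_upwards [hu, eventually_mem_nhdsWithin, hP] with x hx hxS hxP
      linarith [hpos₀ x hxS]
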